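/- arXiv:1606.02058 — 3 statements merged into one kernel-verified Lean document; each statement's English description precedes it below -/
import Mathlib

section
/- Let H, j, N, A, B, Q_σ, λ_j(σ) be as in the min–max setting, and assume λ_j(0) < ∞. Then for every ε ∈ (0,1) there exists a constant L ≥ 0 such that λ_j(σ) is finite for all σ ∈ [0,1−ε] and |λ_j(σ₁) − λ_j(σ₂)| ≤ L·|σ₁−σ₂| for all σ₁, σ₂ ∈ [0,1−ε]; that is, σ ↦ λ_j(σ) is Lipschitz continuous on [0,1−ε] for every ε ∈ (0,1). -/
open scoped ENNReal

/-- The `j`-th min–max value of a functional `Q` on a real inner product space. -/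
noncomputable def minmaxVal {H : Type*} [NormedAddCommGroup H] [InnerProductSpace ℝ H]
    (j : ℕ) (Q : H → ℝ) : ℝ≥0∞ :=
  ⨅ (E : Submodule ℝ H) (_ : Module.finrank ℝ E = j),
    ⨆ (u : H) (_ : u ∈ E) (_ : u ≠ 0), ENNReal.ofReal (Q u / ‖u‖ ^ 2)

/-- The min–max value respects pointwise bounds up to a positive factor. -/
theorem minmaxVal_le_ofReal_mul {H : Type*} [NormedAddCommGroup H] [InnerProductSpace ℝ H]
    (j : ℕ) {Q R : H → ℝ} {c : ℝ} (hc : 0 < c) (h : ∀ u, R u ≤ c * Q u) :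
    minmaxVal j R ≤ ENNReal.ofReal c * minmaxVal j Q := by
  have hc0 : ENNReal.ofReal c ≠ 0 := by simpa using hc
  simp only [minmaxVal, ENNReal.mul_iInf_of_ne hc0 ENNReal.ofReal_ne_top, ENNReal.mul_iSup,
    ← ENNReal.ofReal_mul hc.le, ← mul_div_assoc]
  gcongr
  exact h _

/-- Comparison of the convex combinations of `a` and `b` for two values of the parameter. -/
theorem convexComb_le_mul_convexComb {a b n ε s t : ℝ} (hn : 1 ≤ n) (hb : 0 ≤ b)
    (hba : b ≤ n * a) (hε : 0 < ε) (hs : 0 ≤ s) (hs' : s ≤ 1 - ε) :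
    (1 - t) * a + t * b ≤ (1 + n / ε * |s - t|) * ((1 - s) * a + s * b) := by
  have ha : 0 ≤ a := nonneg_of_mul_nonneg_right (hb.trans hba) (by linarith)
  have hq : ε * a ≤ (1 - s) * a + s * b := by nlinarith [mul_nonneg hs hb]
  have hab : |a - b| ≤ n * a := abs_le.2 ⟨by linarith, by nlinarith⟩
  calc (1 - t) * a + t * b = (1 - s) * a + s * b + (s - t) * (a - b) := by ring
    _ ≤ (1 - s) * a + s * b + |s - t| * (n * a) := by
        refine add_le_add_right ((le_abs_self _).trans ?_) _
        rw [abs_mul]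
        gcongr
    _ = (1 - s) * a + s * b + n / ε * |s - t| * (ε * a) := by field_simp
    _ ≤ (1 - s) * a + s * b + n / ε * |s - t| * ((1 - s) * a + s * b) := by gcongr
    _ = (1 + n / ε * |s - t|) * ((1 - s) * a + s * b) := by ring

/-- Conclusion of Step 2 of the proof of Theorem 3.1: `σ ↦ λ_j(σ)` is Lipschitz
continuous on `[0, 1-ε]` for every `ε ∈ (0,1)`. -/
theorem stmt_4 {H : Type*} [NormedAddCommGroup H] [InnerProductSpace ℝ H]
    (j : ℕ) (hj : 1 ≤ j) (hex : ∃ E : Submodule ℝ H, Module.finrank ℝ E = j)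
    (N : ℕ) (hN : 1 ≤ N) (A B : H → ℝ)
    (hB : ∀ u, 0 ≤ B u) (hBA : ∀ u, B u ≤ (N : ℝ) * A u)
    (lam : ℝ → ℝ≥0∞)
    (hlam : ∀ σ, lam σ = minmaxVal j (fun u => (1 - σ) * A u + σ * B u))
    (hfin : lam 0 < ⊤) :
    ∀ ε ∈ Set.Ioo (0 : ℝ) 1, ∃ L : ℝ, 0 ≤ L ∧
      (∀ σ ∈ Set.Icc (0 : ℝ) (1 - ε), lam σ < ⊤) ∧
      ∀ σ₁ ∈ Set.Icc (0 : ℝ) (1 - ε), ∀ σ₂ ∈ Set.Icc (0 : ℝ) (1 - ε),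
        |(lam σ₁).toReal - (lam σ₂).toReal| ≤ L * |σ₁ - σ₂| := by
  rintro ε ⟨hε, hε1⟩
  have hn : (1 : ℝ) ≤ N := by exact_mod_cast hN
  set K : ℝ := N / ε with hK
  have hK0 : 0 ≤ K := by positivity
  have hcmp : ∀ s ∈ Set.Icc (0 : ℝ) (1 - ε), ∀ t,
      lam t ≤ ENNReal.ofReal (1 + K * |s - t|) * lam s := by
    intro s hs t
    rw [hlam, hlam]
    exact minmaxVal_le_ofReal_mul j (by positivity) fun u =>
      convexComb_le_mul_convexComb hn (hB u) (hBA u) hε hs.1 hs.2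
  have h0 : (0 : ℝ) ∈ Set.Icc (0 : ℝ) (1 - ε) := ⟨le_rfl, by linarith⟩
  have hlt : ∀ t, lam t < ⊤ := fun t =>
    (hcmp 0 h0 t).trans_lt (ENNReal.mul_lt_top ENNReal.ofReal_lt_top hfin)
  have hreal : ∀ s ∈ Set.Icc (0 : ℝ) (1 - ε), ∀ t,
      (lam t).toReal ≤ (1 + K * |s - t|) * (lam s).toReal := by
    intro s hs t
    have h := ENNReal.toReal_mono
      (ENNReal.mul_lt_top ENNReal.ofReal_lt_top (hlt s)).ne (hcmp s hs t)
    rwa [ENNReal.toReal_mul, ENNReal.toReal_ofReal (by positivity)] at h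
  have hbound : ∀ t ∈ Set.Icc (0 : ℝ) (1 - ε),
      (lam t).toReal ≤ (1 + K) * (lam 0).toReal := by
    intro t ht
    refine (hreal 0 h0 t).trans ?_
    have : |0 - t| ≤ 1 := by
      rw [zero_sub, abs_neg, abs_of_nonneg ht.1]
      linarith [ht.2]
    gcongr
    exact mul_le_of_le_one_right hK0 this
  have hdiff : ∀ s ∈ Set.Icc (0 : ℝ) (1 - ε), ∀ t,
      (lam t).toReal - (lam s).toReal ≤ K * ((1 + K) * (lam 0).toReal) * |s - t| := by
    intro s hs t
    have h := mul_le_mul_of_nonneg_left (hbound s hs) (mul_nonneg hK0 (abs_nonneg (s - t)))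
    linarith [hreal s hs t]
  refine ⟨K * ((1 + K) * (lam 0).toReal), by positivity, fun t _ => hlt t,
    fun s hs t ht => abs_sub_le_iff.2 ⟨?_, hdiff s hs t⟩⟩
  rw [abs_sub_comm]
  exact hdiff t ht s
end

section
/- Let H, j, N, A, B, Q_σ, λ_j(σ) be as in the min–max setting. Assume there exists a j-dimensional subspace E₀ of H such that B(u) = 0 for all u ∈ E₀ and S := sup { A(u)/‖u‖² : u ∈ E₀, u ≠ 0 } is finite. Define λ̄_j : [1/2,1] → ℝ by λ̄_j(σ) = λ_j(σ) for σ ∈ [1/2,1) and λ̄_j(1) = 0. Then λ̄_j is real-valued and |λ̄_j(σ₁) − λ̄_j(σ₂)| ≤ S·|σ₁−σ₂| for all σ₁, σ₂ ∈ [1/2,1]; that is, λ̄_j is Lipschitz continuous on [1/2,1] with constant S. -/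
open scoped ENNReal

/-- A pointwise bound between functionals passes to their min–max values. -/
theorem minmaxVal_le_mul {H : Type*} [NormedAddCommGroup H] [InnerProductSpace ℝ H]
    (j : ℕ) {P Q : H → ℝ} {c : ℝ} (hc : 0 < c) (h : ∀ u, P u ≤ c * Q u) :
    minmaxVal j P ≤ ENNReal.ofReal c * minmaxVal j Q := by
  have h0 : ENNReal.ofReal c ≠ 0 := by simpa using hc
  simp only [minmaxVal, ENNReal.mul_iInf_of_ne h0 ENNReal.ofReal_ne_top, ENNReal.mul_iSup]
  refine iInf₂_mono fun E _ => iSup₂_mono fun u _ => iSup_mono fun _ => ?_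
  rw [← ENNReal.ofReal_mul hc.le, ← mul_div_assoc]
  exact ENNReal.ofReal_le_ofReal (div_le_div_of_nonneg_right (h u) (sq_nonneg _))

/-- The cross-multiplied form of `minmaxVal_le_mul`, in real numbers. -/
theorem mul_toReal_minmaxVal_le {H : Type*} [NormedAddCommGroup H] [InnerProductSpace ℝ H]
    (j : ℕ) {P Q : H → ℝ} {a b : ℝ} (ha : 0 < a) (hb : 0 < b)
    (hQ : minmaxVal j Q ≠ ⊤) (h : ∀ u, a * P u ≤ b * Q u) :
    a * (minmaxVal j P).toReal ≤ b * (minmaxVal j Q).toReal := by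
  have hc : 0 < b / a := div_pos hb ha
  have hle := ENNReal.toReal_mono (ENNReal.mul_ne_top ENNReal.ofReal_ne_top hQ)
    (minmaxVal_le_mul j (P := P) (Q := Q) hc fun u => by
      rw [div_mul_eq_mul_div, le_div_iff₀ ha, mul_comm]
      exact h u)
  rwa [ENNReal.toReal_mul, ENNReal.toReal_ofReal hc.le, div_mul_eq_mul_div,
    le_div_iff₀ ha, mul_comm] at hle

/-- A uniform bound on the Rayleigh quotient over one `j`-dimensional subspace bounds the
min–max value. -/
theorem minmaxVal_le_ofReal {H : Type*} [NormedAddCommGroup H] [InnerProductSpace ℝ H]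
    {j : ℕ} {Q : H → ℝ} {E : Submodule ℝ H} (hE : Module.finrank ℝ E = j) {M : ℝ}
    (h : ∀ u ∈ E, u ≠ 0 → Q u / ‖u‖ ^ 2 ≤ M) :
    minmaxVal j Q ≤ ENNReal.ofReal M :=
  iInf₂_le_of_le E hE <| iSup₂_le fun u hu => iSup_le fun hu0 =>
    ENNReal.ofReal_le_ofReal (h u hu hu0)

/-- Conclusion of Step 3 of the proof of Theorem 3.1: the eigenvalue `λ_j(σ)`,
extended by `0` at `σ = 1`, is Lipschitz on `[1/2, 1]` with constant `S`. -/
theorem stmt_7 {H : Type*} [NormedAddCommGroup H] [InnerProductSpace ℝ H]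
    (j : ℕ) (hj : 1 ≤ j) (hex : ∃ E : Submodule ℝ H, Module.finrank ℝ E = j)
    (N : ℕ) (hN : 1 ≤ N) (A B : H → ℝ)
    (hB : ∀ u, 0 ≤ B u) (hBA : ∀ u, B u ≤ (N : ℝ) * A u)
    (lam : ℝ → ℝ≥0∞)
    (hlam : ∀ σ, lam σ = minmaxVal j (fun u => (1 - σ) * A u + σ * B u))
    (E₀ : Submodule ℝ H) (hE₀ : Module.finrank ℝ E₀ = j)
    (hBE₀ : ∀ u ∈ E₀, B u = 0)
    (Sfin : BddAbove {s : ℝ | ∃ u ∈ E₀, u ≠ 0 ∧ s = A u / ‖u‖ ^ 2})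
    (S : ℝ) (hS : S = sSup {s : ℝ | ∃ u ∈ E₀, u ≠ 0 ∧ s = A u / ‖u‖ ^ 2})
    (lamBar : ℝ → ℝ)
    (hlamBar₁ : ∀ σ ∈ Set.Ico (1 / 2 : ℝ) 1, lamBar σ = (lam σ).toReal)
    (hlamBar₂ : lamBar 1 = 0) :
    (∀ σ ∈ Set.Ico (1 / 2 : ℝ) 1, lam σ < ⊤) ∧
      ∀ σ₁ ∈ Set.Icc (1 / 2 : ℝ) 1, ∀ σ₂ ∈ Set.Icc (1 / 2 : ℝ) 1,
        |lamBar σ₁ - lamBar σ₂| ≤ S * |σ₁ - σ₂| := by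
  have hA : ∀ u, 0 ≤ A u := fun u =>
    nonneg_of_mul_nonneg_right ((hB u).trans (hBA u)) (by exact_mod_cast hN)
  have hS0 : 0 ≤ S := by
    rw [hS]
    refine Real.sSup_nonneg ?_
    rintro s ⟨u, -, -, rfl⟩
    exact div_nonneg (hA u) (sq_nonneg _)
  have hbound : ∀ σ ≤ (1 : ℝ), lam σ ≤ ENNReal.ofReal ((1 - σ) * S) := by
    intro σ hσ
    rw [hlam]
    refine minmaxVal_le_ofReal hE₀ fun u hu hu0 => ?_
    rw [hBE₀ u hu, mul_zero, add_zero, mul_div_assoc, hS]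
    exact mul_le_mul_of_nonneg_left (le_csSup Sfin ⟨u, hu, hu0, rfl⟩) (sub_nonneg.2 hσ)
  have hfin : ∀ σ ≤ (1 : ℝ), lam σ < ⊤ := fun σ hσ =>
    (hbound σ hσ).trans_lt ENNReal.ofReal_lt_top
  have hreal : ∀ σ ≤ (1 : ℝ), (lam σ).toReal ≤ (1 - σ) * S := fun σ hσ =>
    ENNReal.toReal_le_of_le_ofReal (mul_nonneg (sub_nonneg.2 hσ) hS0) (hbound σ hσ)
  refine ⟨fun σ hσ => hfin σ hσ.2.le, ?_⟩
  have hbar : ∀ σ ∈ Set.Icc (1 / 2 : ℝ) 1, lamBar σ = (lam σ).toReal := by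
    rintro σ ⟨h1, h2⟩
    rcases h2.lt_or_eq with h | rfl
    · exact hlamBar₁ σ ⟨h1, h⟩
    · have h := hreal 1 le_rfl
      rw [sub_self, zero_mul] at h
      rw [hlamBar₂]
      exact (h.antisymm ENNReal.toReal_nonneg).symm
  have hlt : ∀ σ τ : ℝ, 1 / 2 ≤ σ → σ < τ → τ ≤ 1 →
      |(lam σ).toReal - (lam τ).toReal| ≤ S * (τ - σ) := by
    intro σ τ hσ hστ hτ
    have hσ1 : σ < 1 := hστ.trans_le hτ
    have hLσ := hreal σ hσ1.le
    have hLτ := hreal τ hτ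
    have hup : (lam τ).toReal - (lam σ).toReal ≤ S * (τ - σ) := by
      have key : σ * (lam τ).toReal ≤ τ * (lam σ).toReal := by
        have hne := (hfin σ hσ1.le).ne
        rw [hlam] at hne
        rw [hlam, hlam]
        refine mul_toReal_minmaxVal_le j (by linarith) (by linarith) hne fun u => ?_
        nlinarith [mul_nonneg (sub_nonneg.2 hστ.le) (hA u)]
      have hLS : (lam σ).toReal ≤ σ * S :=
        hLσ.trans (mul_le_mul_of_nonneg_right (by linarith) hS0)
      refine le_of_mul_le_mul_left (a := σ) ?_ (by linarith)
      nlinarith [mul_le_mul_of_nonneg_left hLS (sub_nonneg.2 hστ.le)]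
    have hdown : (lam σ).toReal - (lam τ).toReal ≤ S * (τ - σ) := by
      rcases hτ.lt_or_eq with hτ1 | rfl
      · have key : (1 - τ) * (lam σ).toReal ≤ (1 - σ) * (lam τ).toReal := by
          have hne := (hfin τ hτ).ne
          rw [hlam] at hne
          rw [hlam, hlam]
          refine mul_toReal_minmaxVal_le j (by linarith) (by linarith) hne fun u => ?_
          nlinarith [mul_nonneg (sub_nonneg.2 hστ.le) (hB u)]
        refine le_of_mul_le_mul_left (a := 1 - τ) ?_ (by linarith)
        nlinarith [mul_le_mul_of_nonneg_left hLτ (sub_nonneg.2 hστ.le)]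
      · linarith [(lam 1).toReal_nonneg]
    exact abs_sub_le_iff.2 ⟨hdown, hup⟩
  intro σ₁ h₁ σ₂ h₂
  rw [hbar σ₁ h₁, hbar σ₂ h₂]
  rcases lt_trichotomy σ₁ σ₂ with h | rfl | h
  · rw [abs_sub_comm σ₁, abs_of_pos (sub_pos.2 h)]
    exact hlt σ₁ σ₂ h₁.1 h h₂.2
  · simp
  · rw [abs_sub_comm, abs_of_pos (sub_pos.2 h)]
    exact hlt σ₂ σ₁ h₂.1 h h₁.2
end

section
/- Let N ≥ 1 be a natural number, let Ω be a nonempty bounded open subset of the Euclidean space ℝ^N, and let U be an open set containing the closure of Ω. Let λ ∈ ℝ, and let u : ℝ^N → ℝ be smooth on U (ContDiff of order ∞ on U) and satisfy: Δ(Δu)(x) = λ·u(x) for all x ∈ Ω; Δu(x) = 0 and the Fréchet derivative of Δu vanishes at x for all x in the topological frontier of Ω. Set w := Δu. Then: Δ(Δw)(x) = λ·w(x) for all x ∈ Ω; w(x) = 0 and the Fréchet derivative of w vanishes at x for all x in the frontier of Ω; moreover, if λ ≠ 0 and u is not identically zero on Ω, then w is not identically zero on Ω. -/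
/-- The Laplacian of `f : ℝ^N → ℝ`: the trace of the second derivative,
`Δf(x) = Σ_i ∂²f/∂x_i²(x)`. -/
noncomputable def lap {N : ℕ} (f : EuclideanSpace ℝ (Fin N) → ℝ)
    (x : EuclideanSpace ℝ (Fin N)) : ℝ :=
  ∑ i : Fin N, iteratedFDeriv ℝ 2 f x
    ![EuclideanSpace.single i (1 : ℝ), EuclideanSpace.single i (1 : ℝ)]

/-- The Laplacian at a point depends only on the germ of the function there. -/
theorem lap_congr {N : ℕ} {f g : EuclideanSpace ℝ (Fin N) → ℝ} {x : EuclideanSpace ℝ (Fin N)}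
    (h : f =ᶠ[nhds x] g) : lap f x = lap g x := by
  simp only [lap, (h.iteratedFDeriv ℝ 2).eq_of_nhds]

theorem lap_const_mul {N : ℕ} {f : EuclideanSpace ℝ (Fin N) → ℝ} {x : EuclideanSpace ℝ (Fin N)}
    (c : ℝ) (hf : ContDiffAt ℝ 2 f x) : lap (fun y => c * f y) x = c * lap f x := by
  have h : iteratedFDeriv ℝ 2 (fun y => c * f y) x = c • iteratedFDeriv ℝ 2 f x :=
    iteratedFDeriv_const_smul_apply' (i := 2) (a := c) (by exact_mod_cast hf)
  simp only [lap, h, smul_apply, smul_eq_mul, Finset.mul_sum]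

theorem lap_zero {N : ℕ} (x : EuclideanSpace ℝ (Fin N)) : lap (fun _ => 0) x = 0 := by
  have h : iteratedFDeriv ℝ 2 (fun _ : EuclideanSpace ℝ (Fin N) => (0 : ℝ)) x = 0 :=
    congrFun iteratedFDeriv_fun_zero x
  simp only [lap, h, zero_apply, Finset.sum_const_zero]

/-- The other direction of Theorem 3.3: if `u` is an eigenfunction of the
`σ = 1` Neumann problem for the biharmonic operator with eigenvalue `λ`, then
`w = Δu` solves the Dirichlet problem with the same eigenvalue, and `w` is
nontrivial whenever `λ ≠ 0` and `u` is nontrivial. -/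
theorem stmt_10 (N : ℕ) (hN : 1 ≤ N)
    (Ω U : Set (EuclideanSpace ℝ (Fin N)))
    (hΩne : Ω.Nonempty) (hΩopen : IsOpen Ω) (hΩbd : Bornology.IsBounded Ω)
    (hUopen : IsOpen U) (hUcl : closure Ω ⊆ U)
    (lam : ℝ)
    (u : EuclideanSpace ℝ (Fin N) → ℝ) (hu : ContDiffOn ℝ (⊤ : ℕ∞) u U)
    (heig : ∀ x ∈ Ω, lap (lap u) x = lam * u x)
    (hbd : ∀ x ∈ frontier Ω, lap u x = 0 ∧ fderiv ℝ (lap u) x = 0) :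
    (∀ x ∈ Ω, lap (lap (lap u)) x = lam * lap u x) ∧
    (∀ x ∈ frontier Ω, lap u x = 0 ∧ fderiv ℝ (lap u) x = 0) ∧
    (lam ≠ 0 → (¬ ∀ x ∈ Ω, u x = 0) → ¬ ∀ x ∈ Ω, lap u x = 0) := by
  refine ⟨fun x hx => ?_, hbd, fun hlam hu0 hw => hu0 fun x hx => ?_⟩
  · have hux : ContDiffAt ℝ 2 u x :=
      (hu.contDiffAt (hUopen.mem_nhds (hUcl (subset_closure hx)))).of_le
        (WithTop.coe_le_coe.mpr (le_top : (2 : ℕ∞) ≤ ⊤))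
    rw [lap_congr (Filter.eventually_of_mem (hΩopen.mem_nhds hx) heig), lap_const_mul lam hux]
  · have h : lam * u x = 0 := by
      rw [← heig x hx, lap_congr (Filter.eventually_of_mem (hΩopen.mem_nhds hx) hw), lap_zero]
    exact (mul_eq_zero.mp h).resolve_left hlam
end
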